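/- Let (M,d) be a complete cone metric space over a real Banach space E with cone P, where P is normal with normal constant K. Let S and T be self-maps of M such that (a) T is sequentially continuous, (b) S(M) ⊆ T(M), (c) S and T commute, and (d) the generalized Chatterjea contraction condition d(Sx,Sy) ≤ c·[d(Sx,Ty) + d(Sy,Tx)] holds for all x, y ∈ M, where 0 ≤ c < 1/2. Then S and T have a unique common fixed point. -/

import Mathlib

/-- `P` is a cone in the real Banach space `E`. -/
def IsCone {E : Type*} [NormedAddCommGroup E] [NormedSpace ℝ E] (P : Set E) : Prop :=
  IsClosed P ∧ P.Nonempty ∧ P ≠ {0} ∧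
    (∀ a b : ℝ, 0 ≤ a → 0 ≤ b → ∀ x ∈ P, ∀ y ∈ P, a • x + b • y ∈ P) ∧
    P ∩ (-P) = {0}

/-- The partial order induced by the cone `P`: `x ≤ y` iff `y - x ∈ P`. -/
def ConeLe {E : Type*} [NormedAddCommGroup E] [NormedSpace ℝ E] (P : Set E) (x y : E) : Prop :=
  y - x ∈ P

/-- `x ≪ y` iff `y - x ∈ interior P`. -/
def ConeLt {E : Type*} [NormedAddCommGroup E] [NormedSpace ℝ E] (P : Set E) (x y : E) : Prop :=
  y - x ∈ interior P

/-- `P` is a normal cone with normal constant `K`. -/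
def IsNormalCone {E : Type*} [NormedAddCommGroup E] [NormedSpace ℝ E] (P : Set E) (K : ℝ) : Prop :=
  0 < K ∧ ∀ x y : E, ConeLe P 0 x → ConeLe P x y → ‖x‖ ≤ K * ‖y‖

/-- `d` is a cone metric on `M` with respect to the cone `P`. -/
def IsConeMetric {E M : Type*} [NormedAddCommGroup E] [NormedSpace ℝ E]
    (P : Set E) (d : M → M → E) : Prop :=
  (∀ x y : M, ConeLe P 0 (d x y)) ∧
  (∀ x y : M, d x y = 0 ↔ x = y) ∧
  (∀ x y : M, d x y = d y x) ∧
  (∀ x y z : M, ConeLe P (d x y) (d x z + d z y))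

/-- Convergence of a sequence in a cone metric space. -/
def ConeConv {E M : Type*} [NormedAddCommGroup E] [NormedSpace ℝ E]
    (P : Set E) (d : M → M → E) (u : ℕ → M) (x : M) : Prop :=
  ∀ c : E, ConeLt P 0 c → ∃ n₀ : ℕ, ∀ n ≥ n₀, ConeLt P (d (u n) x) c

/-- Cauchy sequences in a cone metric space. -/
def ConeCauchy {E M : Type*} [NormedAddCommGroup E] [NormedSpace ℝ E]
    (P : Set E) (d : M → M → E) (u : ℕ → M) : Prop :=
  ∀ c : E, ConeLt P 0 c → ∃ n₀ : ℕ, ∀ n ≥ n₀, ∀ m ≥ n₀, ConeLt P (d (u n) (u m)) c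

/-- Completeness of a cone metric space. -/
def ConeComplete {E M : Type*} [NormedAddCommGroup E] [NormedSpace ℝ E]
    (P : Set E) (d : M → M → E) : Prop :=
  ∀ u : ℕ → M, ConeCauchy P d u → ∃ x : M, ConeConv P d u x

/-- Sequential continuity of a self-map of a cone metric space. -/
def ConeSeqContinuous {E M : Type*} [NormedAddCommGroup E] [NormedSpace ℝ E]
    (P : Set E) (d : M → M → E) (T : M → M) : Prop :=
  ∀ (u : ℕ → M) (x : M), ConeConv P d u x → ConeConv P d (fun n => T (u n)) (T x)

/-- `(S, T)` is a pair of generalized Zamfirescu operators with constants `a`, `b`, `c`. -/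
def IsGZO {E M : Type*} [NormedAddCommGroup E] [NormedSpace ℝ E]
    (P : Set E) (d : M → M → E) (S T : M → M) (a b c : ℝ) : Prop :=
  0 ≤ a ∧ a < 1 ∧ 0 ≤ b ∧ b < 1/2 ∧ 0 ≤ c ∧ c < 1/2 ∧
    ∀ x y : M,
      ConeLe P (d (S x) (S y)) (a • d (T x) (T y)) ∨
      ConeLe P (d (S x) (S y)) (b • (d (S x) (T x) + d (S y) (T y))) ∨
      ConeLe P (d (S x) (S y)) (c • (d (S x) (T y) + d (S y) (T x)))

/-- `(S, T)` is a generalized weak contraction. -/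
def IsGWC {E M : Type*} [NormedAddCommGroup E] [NormedSpace ℝ E]
    (P : Set E) (d : M → M → E) (S T : M → M) : Prop :=
  ∃ δ L : ℝ, 0 < δ ∧ δ < 1 ∧ 0 ≤ L ∧
    ∀ x y : M, ConeLe P (d (S x) (S y)) (δ • d (T x) (T y) + L • d (S x) (T x))

section Cone

open Filter Topology Pointwise

variable {E M : Type*} [NormedAddCommGroup E] [NormedSpace ℝ E] {P : Set E} {d : M → M → E}

theorem IsCone.add_mem (hP : IsCone P) {x y : E} (hx : x ∈ P) (hy : y ∈ P) : x + y ∈ P := by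
  simpa using hP.2.2.2.1 1 1 zero_le_one zero_le_one x hx y hy

theorem IsCone.smul_mem (hP : IsCone P) {a : ℝ} (ha : 0 ≤ a) {x : E} (hx : x ∈ P) : a • x ∈ P := by
  simpa using hP.2.2.2.1 a 0 ha le_rfl x hx x hx

theorem IsCone.eq_zero_of_neg_mem (hP : IsCone P) {x : E} (hx : x ∈ P) (hx' : -x ∈ P) : x = 0 := by
  have h : x ∈ P ∩ (-P) := ⟨hx, hx'⟩
  rwa [hP.2.2.2.2] at h

theorem IsCone.eq_zero_of_le_smul (hP : IsCone P) {a : ℝ} (ha : a < 1) {x : E} (hx : x ∈ P)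
    (h : ConeLe P x (a • x)) : x = 0 := by
  refine hP.eq_zero_of_neg_mem hx ?_
  have h1 := hP.smul_mem (inv_nonneg.2 (sub_nonneg.2 ha.le)) h
  have h2 : (1 - a)⁻¹ • (a • x - x) = -x := by
    rw [show a • x - x = (1 - a) • (-x) by module, smul_smul,
      inv_mul_cancel₀ (sub_pos.2 ha).ne', one_smul]
  rwa [h2] at h1

theorem IsCone.add_mem_interior (hP : IsCone P) {x y : E} (hx : x ∈ interior P) (hy : y ∈ P) :
    x + y ∈ interior P := by
  have hsub : interior P + {y} ⊆ P := by
    rintro _ ⟨u, hu, v, rfl, rfl⟩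
    exact hP.add_mem (interior_subset hu) hy
  exact interior_maximal hsub isOpen_interior.add_right (Set.add_mem_add hx rfl)

theorem IsCone.smul_mem_interior (hP : IsCone P) {a : ℝ} (ha : 0 < a) {x : E}
    (hx : x ∈ interior P) : a • x ∈ interior P := by
  have hsub : a • interior P ⊆ P := by
    rintro _ ⟨u, hu, rfl⟩
    exact hP.smul_mem ha.le (interior_subset hu)
  exact interior_maximal hsub (isOpen_interior.smul₀ ha.ne') (Set.smul_mem_smul_set hx)

/-- Non-strict cone inequalities survive a perturbation tending to zero. -/
theorem IsCone.le_of_forall_le_add (hP : IsCone P) {x y : E} {e : ℕ → E}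
    (he : Tendsto e atTop (𝓝 0)) (h : ∀ n, ConeLe P x (y + e n)) : ConeLe P x y := by
  have hlim : Tendsto (fun n => y + e n - x) atTop (𝓝 (y - x)) := by
    simpa using (he.const_add y).sub_const x
  exact hP.1.mem_of_tendsto hlim (Eventually.of_forall h)

/-- Over a normal cone with nonempty interior, convergent sequences have distances to the limit
tending to zero in norm. -/
theorem ConeConv.tendsto_dist {K : ℝ} (hP : IsCone P) (hint : (interior P).Nonempty)
    (hK : IsNormalCone P K) (hd : IsConeMetric P d) {u : ℕ → M} {x : M} (hu : ConeConv P d u x) :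
    Tendsto (fun n => d (u n) x) atTop (𝓝 0) := by
  obtain ⟨e, he⟩ := hint
  rw [Metric.tendsto_atTop]
  intro ε hε
  have hpos : 0 < K * ‖e‖ + 1 := by have := hK.1; positivity
  have hδ : 0 < ε / (K * ‖e‖ + 1) := div_pos hε hpos
  obtain ⟨n₀, hn₀⟩ := hu ((ε / (K * ‖e‖ + 1)) • e)
    (by simpa [ConeLt] using hP.smul_mem_interior hδ he)
  refine ⟨n₀, fun n hn => ?_⟩
  have h := hK.2 _ _ (hd.1 (u n) x) (interior_subset (hn₀ n hn))
  rw [norm_smul, Real.norm_of_nonneg hδ.le] at h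
  rw [dist_zero_right]
  refine h.trans_lt ?_
  rw [show K * (ε / (K * ‖e‖ + 1) * ‖e‖) = ε * (K * ‖e‖) / (K * ‖e‖ + 1) by ring,
    div_lt_iff₀ hpos]
  linarith

/-- A sequence whose tails are dominated by a null sequence is Cauchy. -/
theorem ConeCauchy.of_le_tendsto_zero (hP : IsCone P) (hd : IsConeMetric P d) {u : ℕ → M}
    {e : ℕ → E} (he : Tendsto e atTop (𝓝 0))
    (h : ∀ n k, ConeLe P (d (u n) (u (n + k))) (e n)) : ConeCauchy P d u := by
  intro c hc
  have hlim : Tendsto (fun n => c - e n) atTop (𝓝 (c - 0)) := he.const_sub c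
  obtain ⟨n₀, hn₀⟩ := eventually_atTop.1 (hlim.eventually (isOpen_interior.mem_nhds hc))
  have key : ∀ n ≥ n₀, ∀ k, ConeLt P (d (u n) (u (n + k))) c := by
    intro n hn k
    have := hP.add_mem_interior (hn₀ n hn) (h n k)
    rwa [sub_add_sub_cancel] at this
  refine ⟨n₀, fun n hn m hm => ?_⟩
  rcases le_total n m with hnm | hmn
  · obtain ⟨k, rfl⟩ := Nat.exists_eq_add_of_le hnm
    exact key n hn k
  · obtain ⟨k, rfl⟩ := Nat.exists_eq_add_of_le hmn
    rw [hd.2.2.1]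
    exact key m hm k

/-- A sequence whose consecutive distances decrease geometrically is Cauchy. -/
theorem ConeCauchy.of_le_geometric (hP : IsCone P) (hd : IsConeMetric P d) {u : ℕ → M} {r : ℝ}
    (hr : 0 ≤ r) (hr1 : r < 1)
    (h : ∀ n, ConeLe P (d (u (n + 1)) (u (n + 2))) (r • d (u n) (u (n + 1)))) :
    ConeCauchy P d u := by
  have hstep : ∀ n, ConeLe P (d (u n) (u (n + 1))) (r ^ n • d (u 0) (u 1)) := by
    intro n
    induction n with
    | zero => simpa [ConeLe] using hP.smul_mem le_rfl (hd.1 (u 0) (u 0))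
    | succ n ih =>
      have := hP.add_mem (h n) (hP.smul_mem hr ih)
      unfold ConeLe
      convert this using 1
      rw [pow_succ]
      module
  have hone : 0 < 1 - r := sub_pos.2 hr1
  have hsum : ∀ n k, ConeLe P (d (u n) (u (n + k)))
      ((r ^ n * (1 - r ^ k) * (1 - r)⁻¹) • d (u 0) (u 1)) := by
    intro n k
    induction k with
    | zero =>
      have h0 : d (u n) (u n) = 0 := (hd.2.1 _ _).2 rfl
      simpa [ConeLe, h0] using hd.1 (u n) (u n)
    | succ k ih =>
      have := hP.add_mem (hP.add_mem ih (hstep (n + k))) (hd.2.2.2 (u n) (u (n + k + 1)) (u (n + k)))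
      unfold ConeLe
      have hcoef : r ^ n * (1 - r ^ (k + 1)) * (1 - r)⁻¹
          = r ^ n * (1 - r ^ k) * (1 - r)⁻¹ + r ^ (n + k) := by
        field_simp
        ring
      rw [hcoef]
      convert this using 1
      rw [← add_assoc]
      module
  refine .of_le_tendsto_zero (e := fun n => (r ^ n * (1 - r)⁻¹) • d (u 0) (u 1)) hP hd ?_ ?_
  · simpa using ((tendsto_pow_atTop_nhds_zero_of_lt_one hr hr1).mul_const
      (1 - r)⁻¹).smul_const (d (u 0) (u 1))
  · intro n k
    have hnn : 0 ≤ r ^ n * r ^ k * (1 - r)⁻¹ := by positivity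
    have := hP.add_mem (hsum n k) (hP.smul_mem hnn (hd.1 (u 0) (u 1)))
    unfold ConeLe
    convert this using 1
    module

end Cone

/-- Common fixed point theorem for a generalized Chatterjea contraction pair in a
complete cone metric space. -/
theorem chatterjea_cone_fixed_point {E M : Type*} [NormedAddCommGroup E] [NormedSpace ℝ E]
    [CompleteSpace E] [Nonempty M]
    (P : Set E) (K : ℝ) (d : M → M → E)
    (hP : IsCone P) (hint : (interior P).Nonempty) (hK : IsNormalCone P K)
    (hd : IsConeMetric P d) (hcomp : ConeComplete P d)
    (S T : M → M) (c : ℝ)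
    (hT : ConeSeqContinuous P d T)
    (hrange : Set.range S ⊆ Set.range T)
    (hcomm : ∀ x : M, S (T x) = T (S x))
    (hc : 0 ≤ c) (hc1 : c < 1/2)
    (hcontr : ∀ x y : M,
      ConeLe P (d (S x) (S y)) (c • (d (S x) (T y) + d (S y) (T x)))) :
    ∃! z : M, S z = z ∧ T z = z := by
  have hmem : ∀ x y, d x y ∈ P := fun x y => by simpa [ConeLe] using hd.1 x y
  have hsymm := hd.2.2.1
  have htri := hd.2.2.2
  have h2c : 2 * c < 1 := by linarith
  choose f hf using fun x => hrange (Set.mem_range_self x)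
  let x : ℕ → M := fun n => f^[n] (Classical.arbitrary M)
  have hx : ∀ n, T (x (n + 1)) = S (x n) := fun n => by
    simp only [x, Function.iterate_succ_apply', hf]
  have hone : 0 < 1 - c := by linarith
  have hcauchy : ConeCauchy P d (fun n => S (x n)) := by
    refine .of_le_geometric (r := c * (1 - c)⁻¹) hP hd (by positivity)
      (by rw [← div_eq_mul_inv, div_lt_one hone]; linarith) fun n => ?_
    have h1 := hcontr (x (n + 1)) (x (n + 2))
    rw [hx, hx, (hd.2.1 (S (x (n + 1))) _).2 rfl, hsymm (S (x (n + 2)))] at h1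
    have h2 := hP.add_mem h1 (hP.smul_mem hc (htri (S (x n)) (S (x (n + 2))) (S (x (n + 1)))))
    have h3 := hP.smul_mem (inv_nonneg.2 hone.le) h2
    unfold ConeLe
    convert h3 using 1
    match_scalars <;> field_simp <;> ring
  obtain ⟨z, hz⟩ := hcomp _ hcauchy
  have hzlim := hz.tendsto_dist hP hint hK hd
  have hTlim := (hT _ _ hz).tendsto_dist hP hint hK hd
  have hST : S z = T z := by
    refine (hd.2.1 _ _).1 (hP.eq_zero_of_le_smul (by linarith : c < 1) (hmem _ _) ?_)
    refine hP.le_of_forall_le_add (e := fun n => (1 + c) • d (T (S (x (n + 1)))) (T z)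
      + c • d (T (S (x n))) (T z)) ?_ fun n => ?_
    · simpa using ((hTlim.comp (Filter.tendsto_add_atTop_nat 1)).const_smul (1 + c)).add
        (hTlim.const_smul c)
    · have h1 := hcontr z (S (x n))
      rw [← hx n, hcomm, hx n] at h1
      have h2 := htri (S z) (T z) (T (S (x (n + 1))))
      have h3 := htri (S z) (T (S (x n))) (T z)
      rw [hsymm (T z)] at h3
      have := hP.add_mem (hP.add_mem h1 h2) (hP.smul_mem hc h3)
      unfold ConeLe
      convert this using 1
      module
  have hSz : S z = z := by
    refine (hd.2.1 _ _).1 (hP.eq_zero_of_le_smul h2c (hmem _ _) ?_)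
    refine hP.le_of_forall_le_add (e := fun n => (1 + c) • d (S (x (n + 1))) z
      + c • d (S (x n)) z) ?_ fun n => ?_
    · simpa using ((hzlim.comp (Filter.tendsto_add_atTop_nat 1)).const_smul (1 + c)).add
        (hzlim.const_smul c)
    · have h1 := hcontr z (x (n + 1))
      rw [hx n, ← hST] at h1
      have h2 := htri (S z) z (S (x (n + 1)))
      have h3 := htri (S z) (S (x n)) z
      have h4 := htri (S (x (n + 1))) (S z) z
      rw [hsymm z] at h3
      rw [hsymm z] at h4
      have := hP.add_mem (hP.add_mem h1 h2) (hP.smul_mem hc (hP.add_mem h3 h4))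
      unfold ConeLe
      convert this using 1
      module
  refine ⟨z, ⟨hSz, hST ▸ hSz⟩, ?_⟩
  rintro w ⟨hSw, hTw⟩
  refine (hd.2.1 _ _).1 (hP.eq_zero_of_le_smul h2c (hmem _ _) ?_)
  have h := hcontr w z
  rw [← hST, hSw, hSz, hTw, hsymm z w] at h
  unfold ConeLe at h ⊢
  convert h using 1
  module
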